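/- The minimal value of the Lyapunov exponent of the Gauss map is c₀ = 2 log((1+√5)/2): for every irrational β ∈ (0,1) for which the limit λ(β) = lim_{n→∞} (2/n) Σ_{k=0}^{n−1} log(1/T^k(β)) exists, one has λ(β) ≥ 2 log((1+√5)/2); moreover, for β = (√5−1)/2 the limit exists and λ(β) = 2 log((1+√5)/2). -/

import Mathlib

open Filter Topology

/-- The Gauss map `T : [0,1] → [0,1]`, `T 0 = 0`, `T x = 1/x - ⌊1/x⌋`. -/
noncomputable def gaussMap (x : ℝ) : ℝ := if x = 0 then 0 else 1 / x - ⌊1 / x⌋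

/-- `cfa β n = a_{n+1}(β) = ⌊1 / T^n β⌋`, the partial quotients of the
continued fraction expansion of `β`. -/
noncomputable def cfa (β : ℝ) (n : ℕ) : ℤ := ⌊1 / (gaussMap^[n] β)⌋

/-- `pNum β (n+1) = p_n(β)`: the numerators of the convergents,
with `p_{-1} = 1`, `p_0 = 0`, `p_n = a_n p_{n-1} + p_{n-2}`. -/
noncomputable def pNum (β : ℝ) : ℕ → ℤ
  | 0 => 1
  | 1 => 0
  | n + 2 => cfa β n * pNum β (n + 1) + pNum β n

/-- `qDen β (n+1) = q_n(β)`: the denominators of the convergents,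
with `q_{-1} = 0`, `q_0 = 1`, `q_n = a_n q_{n-1} + q_{n-2}`. -/
noncomputable def qDen (β : ℝ) : ℕ → ℤ
  | 0 => 0
  | 1 => 1
  | n + 2 => cfa β n * qDen β (n + 1) + qDen β n

/-- The `n`-th Birkhoff average whose limit is the Lyapunov exponent of the
Gauss map at `β`:  `(2/n) ∑_{k=0}^{n-1} log (1 / T^k β)`. -/
noncomputable def lyapAvg (β : ℝ) (n : ℕ) : ℝ :=
  (2 / (n : ℝ)) * ∑ k ∈ Finset.range n, Real.log (1 / gaussMap^[k] β)

lemma gaussMap_mem (x : ℝ) (hx : Irrational x) (h0 : 0 < x) :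
    Irrational (gaussMap x) ∧ 0 < gaussMap x ∧ gaussMap x < 1 := by
  have hx0 : x ≠ 0 := h0.ne'
  have hirr : Irrational (gaussMap x) := by
    unfold gaussMap
    rw [if_neg hx0, one_div]
    exact (irrational_inv_iff.mpr hx).sub_intCast _
  refine ⟨hirr, ?_, ?_⟩
  · have h : 0 ≤ gaussMap x := by
      unfold gaussMap
      rw [if_neg hx0]
      linarith [Int.floor_le (1 / x)]
    exact lt_of_le_of_ne h (fun e => hirr.ne_zero e.symm)
  · unfold gaussMap
    rw [if_neg hx0]
    linarith [Int.lt_floor_add_one (1 / x)]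

lemma gaussMap_mul_le (x : ℝ) (h0 : 0 < x) (h1 : x < 1) : x * gaussMap x ≤ 1 - x := by
  have hf : (1 : ℤ) ≤ ⌊1 / x⌋ := by
    rw [Int.le_floor]
    push_cast
    rw [le_div_iff₀ h0]
    linarith
  have hf' : (1 : ℝ) ≤ (⌊1 / x⌋ : ℝ) := by exact_mod_cast hf
  unfold gaussMap
  rw [if_neg h0.ne', mul_sub, mul_one_div_cancel h0.ne']
  nlinarith

lemma iter_mem (β : ℝ) (hx : Irrational β) (h0 : 0 < β) (h1 : β < 1) (n : ℕ) :
    Irrational (gaussMap^[n] β) ∧ 0 < gaussMap^[n] β ∧ gaussMap^[n] β < 1 := by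
  induction n with
  | zero => exact ⟨hx, h0, h1⟩
  | succ n ih =>
    rw [Function.iterate_succ_apply']
    exact gaussMap_mem _ ih.1 ih.2.1

lemma phi_pos : (0 : ℝ) < (1 + Real.sqrt 5) / 2 := by positivity

lemma psi_mul : (1 + Real.sqrt 5) / 2 * ((Real.sqrt 5 - 1) / 2) = 1 := by
  nlinarith [Real.sq_sqrt (show (0 : ℝ) ≤ 5 by norm_num)]

lemma sqrt5_bounds : 2 < Real.sqrt 5 ∧ Real.sqrt 5 < 3 := by
  constructor
  · rw [Real.lt_sqrt (by norm_num)]; norm_num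
  · rw [Real.sqrt_lt' (by norm_num)]; norm_num

lemma prod_bound (β : ℝ) (hx : Irrational β) (h0 : 0 < β) (h1 : β < 1) (n : ℕ) :
    ((1 + Real.sqrt 5) / 2) ^ n * ((∏ k ∈ Finset.range n, gaussMap^[k] β) *
      (1 + (Real.sqrt 5 - 1) / 2 * gaussMap^[n] β)) ≤ 2 := by
  induction n with
  | zero =>
    have := sqrt5_bounds
    simp
    nlinarith
  | succ n ih =>
    refine le_trans ?_ ih
    rw [pow_succ, mul_assoc, Finset.prod_range_succ]
    obtain ⟨-, hp, hl⟩ := iter_mem β hx h0 h1 n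
    have hP : 0 ≤ ∏ k ∈ Finset.range n, gaussMap^[k] β :=
      Finset.prod_nonneg fun k _ => (iter_mem β hx h0 h1 k).2.1.le
    have hg := gaussMap_mul_le _ hp hl
    rw [Function.iterate_succ_apply']
    set x := gaussMap^[n] β
    set y := gaussMap x
    set P := ∏ k ∈ Finset.range n, gaussMap^[k] β
    refine mul_le_mul_of_nonneg_left ?_ (pow_nonneg phi_pos.le n)
    have e : (1 + Real.sqrt 5) / 2 * (P * x * (1 + (Real.sqrt 5 - 1) / 2 * y))
        = P * ((1 + Real.sqrt 5) / 2 * x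
          + (1 + Real.sqrt 5) / 2 * ((Real.sqrt 5 - 1) / 2) * (x * y)) := by ring
    rw [e, psi_mul]
    refine mul_le_mul_of_nonneg_left ?_ hP
    linarith

lemma lyapAvg_ge (β : ℝ) (hx : Irrational β) (h0 : 0 < β) (h1 : β < 1) (n : ℕ) (hn : 0 < n) :
    2 * Real.log ((1 + Real.sqrt 5) / 2) - 2 * Real.log 2 / n ≤ lyapAvg β n := by
  have hP : 0 < ∏ k ∈ Finset.range n, gaussMap^[k] β :=
    Finset.prod_pos fun k _ => (iter_mem β hx h0 h1 k).2.1
  have hb := prod_bound β hx h0 h1 n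
  have hpn : 0 < ((1 + Real.sqrt 5) / 2) ^ n := pow_pos phi_pos n
  have hb2 : ((1 + Real.sqrt 5) / 2) ^ n * (∏ k ∈ Finset.range n, gaussMap^[k] β) ≤ 2 := by
    refine le_trans ?_ hb
    refine mul_le_mul_of_nonneg_left ?_ hpn.le
    refine le_mul_of_one_le_right hP.le ?_
    have h5 := sqrt5_bounds
    have := mul_nonneg (show 0 ≤ (Real.sqrt 5 - 1) / 2 by linarith)
      (iter_mem β hx h0 h1 n).2.1.le
    linarith
  have hl := Real.log_le_log (mul_pos hpn hP) hb2
  rw [Real.log_mul hpn.ne' hP.ne', Real.log_pow,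
    Real.log_prod (fun k _ => (iter_mem β hx h0 h1 k).2.1.ne')] at hl
  have hn' : (0 : ℝ) < n := by exact_mod_cast hn
  unfold lyapAvg
  simp only [one_div, Real.log_inv, Finset.sum_neg_distrib]
  set S := ∑ k ∈ Finset.range n, Real.log (gaussMap^[k] β)
  have e : 2 * Real.log ((1 + Real.sqrt 5) / 2) - 2 * Real.log 2 / n
      = 2 / n * (n * Real.log ((1 + Real.sqrt 5) / 2) - Real.log 2) := by
    field_simp
  rw [e]
  refine mul_le_mul_of_nonneg_left ?_ (by positivity)
  linarith

lemma gaussMap_golden : gaussMap ((Real.sqrt 5 - 1) / 2) = (Real.sqrt 5 - 1) / 2 := by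
  have h5 := sqrt5_bounds
  have hne : (Real.sqrt 5 - 1) / 2 ≠ 0 := by linarith
  have hinv : 1 / ((Real.sqrt 5 - 1) / 2) = (1 + Real.sqrt 5) / 2 := by
    rw [div_eq_iff hne, psi_mul]
  have hf : ⌊(1 + Real.sqrt 5) / 2⌋ = 1 := by
    rw [Int.floor_eq_iff]
    push_cast
    constructor <;> linarith
  unfold gaussMap
  rw [if_neg hne, hinv, hf]
  push_cast
  ring

/-- The minimal value of the Lyapunov exponent of the Gauss map is
`c₀ = 2 log((1+√5)/2)`: every irrational `β ∈ (0,1)` where the Lyapunov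
exponent exists satisfies `λ(β) ≥ c₀`, and for `β = (√5-1)/2` the limit exists
and equals `c₀`. -/
theorem lyapunov_min_golden :
    (∀ β : ℝ, Irrational β → 0 < β → β < 1 → ∀ l : ℝ,
      Tendsto (lyapAvg β) atTop (𝓝 l) →
        2 * Real.log ((1 + Real.sqrt 5) / 2) ≤ l) ∧
    Tendsto (lyapAvg ((Real.sqrt 5 - 1) / 2)) atTop
      (𝓝 (2 * Real.log ((1 + Real.sqrt 5) / 2))) := by
  constructor
  · intro β hx h0 h1 l hl
    have ht : Tendsto (fun n : ℕ => 2 * Real.log ((1 + Real.sqrt 5) / 2) - 2 * Real.log 2 / n)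
        atTop (𝓝 (2 * Real.log ((1 + Real.sqrt 5) / 2) - 0)) :=
      tendsto_const_nhds.sub (tendsto_const_div_atTop_nhds_zero_nat _)
    rw [sub_zero] at ht
    refine le_of_tendsto_of_tendsto ht hl ?_
    filter_upwards [eventually_gt_atTop 0] with n hn
    exact lyapAvg_ge β hx h0 h1 n hn
  · refine tendsto_const_nhds.congr' ?_
    filter_upwards [eventually_gt_atTop 0] with n hn
    have hn' : (n : ℝ) ≠ 0 := by exact_mod_cast hn.ne'
    have h5 := sqrt5_bounds
    have hne : (Real.sqrt 5 - 1) / 2 ≠ 0 := by linarith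
    have hinv : 1 / ((Real.sqrt 5 - 1) / 2) = (1 + Real.sqrt 5) / 2 := by
      rw [div_eq_iff hne, psi_mul]
    unfold lyapAvg
    simp only [Function.iterate_fixed gaussMap_golden, hinv, Finset.sum_const,
      Finset.card_range, nsmul_eq_mul]
    field_simp
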